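/- arXiv:math/0409477 — 3 statements merged into one kernel-verified Lean document; each statement's English description precedes it below -/
import Mathlib

section
/- Let A be a Q-category all of whose endo-hom-arrows A(a,a) : ta → ta split in Q (i.e. for each a there are an object A_a and Q-arrows f_a : ta → A_a, u_a : A_a → ta with u_a∘f_a = A(a,a) and f_a∘u_a = 1_{A_a}). Then A is isomorphic in the quantaloid Dist(Q) to a normal Q-category, namely the Q-category Ã with objects A₀, types t̃a = A_a and hom-arrows Ã(a',a) = f_{a'}∘A(a',a)∘u_a; the distributors Φ : A ⇸ Ã, Φ(a',a) = f_{a'}∘A(a',a), and Ψ : Ã ⇸ A, Ψ(a',a) = A(a',a)∘u_a, are each other's inverse. -/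
open CategoryTheory

universe u

variable (Q : Type u) [SmallCategory Q] [∀ X Y : Q, CompleteLattice (X ⟶ Y)]

/-- A (small) quantaloid: a category whose hom-sets are complete lattices and in which
composition distributes on both sides over arbitrary suprema. -/
class IsQuantaloid : Prop where
  comp_sSup : ∀ {X Y Z : Q} (f : X ⟶ Y) (S : Set (Y ⟶ Z)),
      f ≫ sSup S = ⨆ g ∈ S, f ≫ g
  sSup_comp : ∀ {X Y Z : Q} (S : Set (X ⟶ Y)) (g : Y ⟶ Z),
      sSup S ≫ g = ⨆ f ∈ S, f ≫ g

/-- A `Q`-typed set together with a matrix of hom-arrows.  `A.hom a a' : A.ty a ⟶ A.ty a'`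
is the hom-arrow written `A(a',a) : ta → ta'` in the paper. -/
structure QGraph where
  Obj : Type u
  ty : Obj → Q
  hom : ∀ a a' : Obj, ty a ⟶ ty a'

variable {Q}

namespace QGraph

/-- `Q`-semicategory: composition inequality. -/
def IsSemiCat (A : QGraph Q) : Prop :=
  ∀ a a' a'' : A.Obj, A.hom a a' ≫ A.hom a' a'' ≤ A.hom a a''

/-- Regular `Q`-semicategory. -/
def IsRegular (A : QGraph Q) : Prop :=
  A.IsSemiCat ∧ ∀ a a'' : A.Obj, (⨆ a' : A.Obj, A.hom a a' ≫ A.hom a' a'') = A.hom a a''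

/-- Totally regular `Q`-semicategory (elementary characterization):
`A(a,a)∘A(a,a') = A(a,a')` and `A(a',a)∘A(a,a) = A(a',a)`. -/
def IsTR (A : QGraph Q) : Prop :=
  A.IsSemiCat ∧ (∀ a a' : A.Obj, A.hom a a ≫ A.hom a a' = A.hom a a')
    ∧ (∀ a a' : A.Obj, A.hom a' a ≫ A.hom a a = A.hom a' a)

/-- `Q`-category: composition inequality plus unit inequality. -/
def IsCat (A : QGraph Q) : Prop :=
  A.IsSemiCat ∧ ∀ a : A.Obj, 𝟙 (A.ty a) ≤ A.hom a a

/-- Normal `Q`-category: all endo-hom-arrows are identities. -/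
def IsNormal (A : QGraph Q) : Prop :=
  ∀ a : A.Obj, A.hom a a = 𝟙 (A.ty a)

/-- The one-object structure `*_e` on an arrow `e : X ⟶ X`. -/
def single (X : Q) (e : X ⟶ X) : QGraph Q :=
  ⟨PUnit, fun _ => X, fun _ _ => e⟩

/-- Full subgraph determined by a subset of the objects. -/
def restrict (A : QGraph Q) (s : Set A.Obj) : QGraph Q :=
  ⟨s, fun x => A.ty x, fun x y => A.hom x y⟩

end QGraph

/-- A matrix of `Q`-arrows: `Φ a b : ty a ⟶ ty b` is the paper's `Φ(b,a) : ta → tb`. -/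
def QMat (A B : QGraph Q) : Type u :=
  ∀ (a : A.Obj) (b : B.Obj), A.ty a ⟶ B.ty b

/-- Composition of matrices: `(Ψ⊗Φ)(c,a) = ⋁_b Ψ(c,b)∘Φ(b,a)`. -/
def matComp {A B C : QGraph Q} (Φ : QMat A B) (Ψ : QMat B C) : QMat A C :=
  fun a c => ⨆ b, Φ a b ≫ Ψ b c

/-- (Plain) distributor between `Q`-categories. -/
def IsDist {A B : QGraph Q} (Φ : QMat A B) : Prop :=
  (∀ (a : A.Obj) (b b' : B.Obj), Φ a b ≫ B.hom b b' ≤ Φ a b') ∧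
  (∀ (a' a : A.Obj) (b : B.Obj), A.hom a' a ≫ Φ a b ≤ Φ a' b)

/-- Regular semidistributor. -/
def IsRSDist {A B : QGraph Q} (Φ : QMat A B) : Prop :=
  (∀ (a : A.Obj) (b' : B.Obj), (⨆ b, Φ a b ≫ B.hom b b') = Φ a b') ∧
  (∀ (a' : A.Obj) (b : B.Obj), (⨆ a, A.hom a' a ≫ Φ a b) = Φ a' b)

/-- Adjunction `Φ ⊣ Ψ` (unit and counit inequalities) between matrices. -/
def MatAdj {A B : QGraph Q} (Φ : QMat A B) (Ψ : QMat B A) : Prop :=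
  (∀ a a', A.hom a a' ≤ matComp Φ Ψ a a') ∧
  (∀ b b', matComp Ψ Φ b b' ≤ B.hom b b')

/-- A type-preserving object map. -/
structure ObjMap (A B : QGraph Q) where
  map : A.Obj → B.Obj
  ty_eq : ∀ a, B.ty (map a) = A.ty a

namespace ObjMap

variable {A B C : QGraph Q}

/-- The matrix `B(-,F-)` induced by an object map. -/
def graph (F : ObjMap A B) : QMat A B :=
  fun a b => eqToHom (F.ty_eq a).symm ≫ B.hom (F.map a) b

/-- The matrix `B(F-,-)` induced by an object map. -/
def cograph (F : ObjMap A B) : QMat B A :=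
  fun b a => B.hom b (F.map a) ≫ eqToHom (F.ty_eq a)

/-- Semifunctor: `A(a',a) ≤ B(Fa',Fa)`. -/
def IsSemiFun (F : ObjMap A B) : Prop :=
  ∀ a a', A.hom a a' ≤
    eqToHom (F.ty_eq a).symm ≫ B.hom (F.map a) (F.map a') ≫ eqToHom (F.ty_eq a')

/-- Fully faithful semifunctor: `A(a',a) = B(Fa',Fa)`. -/
def IsFullyFaithful (F : ObjMap A B) : Prop :=
  ∀ a a', A.hom a a' =
    eqToHom (F.ty_eq a).symm ≫ B.hom (F.map a) (F.map a') ≫ eqToHom (F.ty_eq a')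

/-- Regular semifunctor: a semifunctor such that `⋁_{a'} B(b,Fa')∘A(a',a) = B(b,Fa)` and
`⋁_{a'} A(a,a')∘B(Fa',b) = B(Fa,b)`. -/
def IsRSFun (F : ObjMap A B) : Prop :=
  F.IsSemiFun ∧
  (∀ a b, (⨆ a', A.hom a a' ≫ F.graph a' b) = F.graph a b) ∧
  (∀ a b, (⨆ a', F.cograph b a' ≫ A.hom a' a) = F.cograph b a)

/-- Composition of object maps (`G ∘ F`). -/
def comp (F : ObjMap A B) (G : ObjMap B C) : ObjMap A C :=
  ⟨fun a => G.map (F.map a), fun a => (G.ty_eq (F.map a)).trans (F.ty_eq a)⟩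

end ObjMap

/-- A left adjoint matrix `Φ` (with right adjoint `Ψ`) converges when it is induced by a
regular semifunctor, i.e. `Φ = B(-,F-)` and `Ψ = B(F-,-)`. -/
def Converges {A B : QGraph Q} (Φ : QMat A B) (Ψ : QMat B A) : Prop :=
  ∃ F : ObjMap A B, F.IsRSFun ∧ (∀ a b, Φ a b = F.graph a b) ∧ (∀ b a, Ψ b a = F.cograph b a)

/-- Cauchy completeness of a totally regular `Q`-semicategory:
every Cauchy (left adjoint) regular semidistributor into it converges. -/
def CauchyComplete (B : QGraph Q) : Prop :=
  ∀ (A : QGraph Q), A.IsTR → ∀ (Φ : QMat A B) (Ψ : QMat B A),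
    IsRSDist Φ → IsRSDist Ψ → MatAdj Φ Ψ → Converges Φ Ψ

/-- Cauchy completeness of a `Q`-category: every left adjoint distributor into it
is induced by a functor. -/
def CatCauchyComplete (B : QGraph Q) : Prop :=
  ∀ (A : QGraph Q), A.IsCat → ∀ (Φ : QMat A B) (Ψ : QMat B A),
    IsDist Φ → IsDist Ψ → MatAdj Φ Ψ →
    ∃ F : ObjMap A B, F.IsSemiFun ∧ ∀ a b, Φ a b = F.graph a b

/-- An object `a` of a regular `Q`-semicategory is stable when it is the value of a regular
semifunctor on a one-object regular `Q`-semicategory `*_e` (`e` an idempotent). -/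
def QGraph.Stable (A : QGraph Q) (a : A.Obj) : Prop :=
  ∃ (X : Q) (e : X ⟶ X), e ≫ e = e ∧
    ∃ F : ObjMap (QGraph.single X e) A, F.IsRSFun ∧ F.map PUnit.unit = a

theorem IsQuantaloid.comp_le_comp [IsQuantaloid Q] {X Y Z : Q} {f f' : X ⟶ Y} {g g' : Y ⟶ Z}
    (hf : f ≤ f') (hg : g ≤ g') : f ≫ g ≤ f' ≫ g' := by
  have h₁ : f ≫ g ≤ f' ≫ g := by
    have h := IsQuantaloid.sSup_comp {f, f'} g
    rw [sSup_pair, sup_eq_right.2 hf] at h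
    rw [h]
    exact le_iSup₂_of_le f (by simp) le_rfl
  have h₂ : f' ≫ g ≤ f' ≫ g' := by
    have h := IsQuantaloid.comp_sSup f' {g, g'}
    rw [sSup_pair, sup_eq_right.2 hg] at h
    rw [h]
    exact le_iSup₂_of_le g (by simp) le_rfl
  exact h₁.trans h₂

theorem QGraph.IsCat.hom_self_comp [IsQuantaloid Q] {A : QGraph Q} (hA : A.IsCat)
    (a a' : A.Obj) : A.hom a a ≫ A.hom a a' = A.hom a a' :=
  le_antisymm (hA.1 a a a') <| by
    simpa using IsQuantaloid.comp_le_comp (hA.2 a) (le_refl (A.hom a a'))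

theorem QGraph.IsCat.hom_comp_self [IsQuantaloid Q] {A : QGraph Q} (hA : A.IsCat)
    (a a' : A.Obj) : A.hom a a' ≫ A.hom a' a' = A.hom a a' :=
  le_antisymm (hA.1 a a' a') <| by
    simpa using IsQuantaloid.comp_le_comp (le_refl (A.hom a a')) (hA.2 a')

/-- a `Q`-category whose endo-hom-arrows split is isomorphic in `Dist(Q)`
to a normal `Q`-category `Ã`, via the inverse pair of distributors
`Φ(a',a) = f_{a'}∘A(a',a)` and `Ψ(a',a) = A(a',a)∘u_a`. -/
theorem split_endos_normalization [IsQuantaloid Q] (A : QGraph Q) (hA : A.IsCat)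
    (As : A.Obj → Q) (f : ∀ a, A.ty a ⟶ As a) (u : ∀ a, As a ⟶ A.ty a)
    (hsplit : ∀ a, f a ≫ u a = A.hom a a) (hretr : ∀ a, u a ≫ f a = 𝟙 (As a)) :
    let At : QGraph Q := ⟨A.Obj, As, fun a a' => u a ≫ A.hom a a' ≫ f a'⟩
    let Φ : QMat A At := fun a a' => A.hom a a' ≫ f a'
    let Ψ : QMat At A := fun a a' => u a ≫ A.hom a a'
    At.IsCat ∧ At.IsNormal ∧ IsDist Φ ∧ IsDist Ψ ∧
      (∀ a a', matComp Φ Ψ a a' = A.hom a a') ∧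
      (∀ a a', matComp Ψ Φ a a' = At.hom a a') := by
  intro At Φ Ψ
  have comp_split {X : Q} (a b c : A.Obj) (g : A.ty c ⟶ X) :
      A.hom a b ≫ f b ≫ u b ≫ A.hom b c ≫ g = (A.hom a b ≫ A.hom b c) ≫ g := by
    rw [← Category.assoc (f b), hsplit, ← Category.assoc (A.hom a b), hA.hom_comp_self,
      Category.assoc]
  have comp_split' (a b c : A.Obj) :
      A.hom a b ≫ f b ≫ u b ≫ A.hom b c = A.hom a b ≫ A.hom b c := by
    simpa using comp_split a b c (𝟙 _)
  have whisker {W X : Q} (a b c : A.Obj) (g : W ⟶ A.ty a) (h : A.ty c ⟶ X) :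
      g ≫ (A.hom a b ≫ A.hom b c) ≫ h ≤ g ≫ A.hom a c ≫ h :=
    IsQuantaloid.comp_le_comp le_rfl (IsQuantaloid.comp_le_comp (hA.1 a b c) le_rfl)
  have normal : At.IsNormal := fun a => by
    change u a ≫ A.hom a a ≫ f a = 𝟙 (As a)
    rw [← hsplit, Category.assoc, hretr, Category.comp_id, hretr]
  refine ⟨⟨fun a b c => ?_, fun a => (normal a).ge⟩, normal, ⟨fun a b c => ?_, fun a b c => ?_⟩,
    ⟨fun a b c => ?_, fun a b c => ?_⟩, fun a c => le_antisymm (iSup_le fun b => ?_) ?_,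
    fun a c => le_antisymm (iSup_le fun b => ?_) ?_⟩
  · change (u a ≫ A.hom a b ≫ f b) ≫ u b ≫ A.hom b c ≫ f c ≤ u a ≫ A.hom a c ≫ f c
    simpa only [Category.assoc, comp_split] using whisker a b c (u a) (f c)
  · change (A.hom a b ≫ f b) ≫ u b ≫ A.hom b c ≫ f c ≤ A.hom a c ≫ f c
    rw [Category.assoc, comp_split]
    exact IsQuantaloid.comp_le_comp (hA.1 a b c) le_rfl
  · change A.hom a b ≫ A.hom b c ≫ f c ≤ A.hom a c ≫ f c
    rw [← Category.assoc]
    exact IsQuantaloid.comp_le_comp (hA.1 a b c) le_rfl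
  · change (u a ≫ A.hom a b) ≫ A.hom b c ≤ u a ≫ A.hom a c
    rw [Category.assoc]
    exact IsQuantaloid.comp_le_comp le_rfl (hA.1 a b c)
  · change (u a ≫ A.hom a b ≫ f b) ≫ u b ≫ A.hom b c ≤ u a ≫ A.hom a c
    simp only [Category.assoc, comp_split']
    exact IsQuantaloid.comp_le_comp le_rfl (hA.1 a b c)
  · change (A.hom a b ≫ f b) ≫ u b ≫ A.hom b c ≤ A.hom a c
    rw [Category.assoc, comp_split']
    exact hA.1 a b c
  · refine le_iSup_of_le (f := fun b => Φ a b ≫ Ψ b c) a (ge_of_eq ?_)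
    change (A.hom a a ≫ f a) ≫ u a ≫ A.hom a c = A.hom a c
    rw [Category.assoc, comp_split', hA.hom_self_comp]
  · change (u a ≫ A.hom a b) ≫ A.hom b c ≫ f c ≤ u a ≫ A.hom a c ≫ f c
    simpa only [Category.assoc] using whisker a b c (u a) (f c)
  · refine le_iSup_of_le (f := fun b => Ψ a b ≫ Φ b c) a (ge_of_eq ?_)
    change (u a ≫ A.hom a a) ≫ A.hom a c ≫ f c = u a ≫ A.hom a c ≫ f c
    rw [Category.assoc, ← Category.assoc (A.hom a a), hA.hom_self_comp]
end

section
/- The homomorphism (ˆ) : TRSDist(Q) → Dist_n(Idm(Q)), sending a totally regular Q-semicategory A to the normal Idm(Q)-category Â with the same objects, types t̂a = A(a,a) and hom-arrows Â(a',a) = A(a',a), and sending a regular semidistributor Φ to the distributor Φ̂ with Φ̂(b,a) = Φ(b,a), is an equivalence of quantaloids: it is fully faithful (an order-isomorphism on each hom-lattice) and surjective on objects. -/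
open CategoryTheory

universe u

variable (Q : Type u) [SmallCategory Q] [∀ X Y : Q, CompleteLattice (X ⟶ Y)]

variable {Q}

variable (Q) in
/-- The split-idempotent completion `Idm(Q)`: objects are the idempotent arrows of `Q`. -/
structure Idm where
  obj : Q
  e : obj ⟶ obj
  idem : e ≫ e = e

/-- Arrows of `Idm(Q)`: `Q`-arrows compatible with the idempotents;
composition and identities as in the paper. -/
instance : SmallCategory (Idm Q) where
  Hom p q := {b : p.obj ⟶ q.obj // p.e ≫ b = b ∧ b ≫ q.e = b}
  id p := ⟨p.e, p.idem, p.idem⟩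
  comp f g := ⟨f.1 ≫ g.1,
    by rw [← Category.assoc, f.2.1],
    by rw [Category.assoc, g.2.2]⟩
  id_comp f := Subtype.ext f.2.1
  comp_id f := Subtype.ext f.2.2
  assoc f g h := Subtype.ext (Category.assoc f.1 g.1 h.1)

instance (p q : Idm Q) : PartialOrder (p ⟶ q) :=
  inferInstanceAs (PartialOrder {b : p.obj ⟶ q.obj // p.e ≫ b = b ∧ b ≫ q.e = b})

variable [IsQuantaloid Q]

instance (p q : Idm Q) : SupSet (p ⟶ q) where
  sSup S := ⟨sSup (Subtype.val '' S), by
    have h : ∀ g ∈ Subtype.val '' S, p.e ≫ g = g := by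
      rintro g ⟨b, -, rfl⟩; exact b.2.1
    rw [IsQuantaloid.comp_sSup, sSup_eq_iSup]
    exact biSup_congr h, by
    have h : ∀ g ∈ Subtype.val '' S, g ≫ q.e = g := by
      rintro g ⟨b, -, rfl⟩; exact b.2.2
    rw [IsQuantaloid.sSup_comp, sSup_eq_iSup]
    exact biSup_congr h⟩

/-- The hom-objects of `Idm(Q)` are complete lattices (local structure inherited from `Q`). -/
instance (p q : Idm Q) : CompleteLattice (p ⟶ q) :=
  completeLatticeOfSup _ (fun S => by
    constructor
    · intro x hx
      show x.1 ≤ sSup (Subtype.val '' S)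
      exact le_sSup (Set.mem_image_of_mem _ hx)
    · intro w hw
      show sSup (Subtype.val '' S) ≤ w.1
      apply sSup_le
      rintro g ⟨b, hb, rfl⟩
      exact hw hb)

/-- The normal `Idm(Q)`-category `Â` associated to a totally regular `Q`-semicategory `A`:
same objects, types `t̂a = A(a,a)` and hom-arrows `Â(a',a) = A(a',a)`. -/
def QGraph.hat (A : QGraph Q) (hA : A.IsTR) : QGraph (Idm Q) where
  Obj := A.Obj
  ty := fun a => ⟨A.ty a, A.hom a a, hA.2.1 a a⟩
  hom := fun a a' => ⟨A.hom a a', hA.2.1 a a', hA.2.2 a' a⟩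

namespace IsQuantaloid

theorem iSup_comp {ι : Type*} {X Y Z : Q} (f : ι → (X ⟶ Y)) (g : Y ⟶ Z) :
    (⨆ i, f i) ≫ g = ⨆ i, f i ≫ g := by
  rw [iSup, sSup_comp, iSup_range]

theorem comp_iSup {ι : Type*} {X Y Z : Q} (f : X ⟶ Y) (g : ι → (Y ⟶ Z)) :
    f ≫ (⨆ i, g i) = ⨆ i, f ≫ g i := by
  rw [iSup, comp_sSup, iSup_range]

end IsQuantaloid

namespace IsRSDist

variable {A B : QGraph Q} {Φ : QMat A B}

theorem comp_hom_self (hB : B.IsTR) (hΦ : IsRSDist Φ) (a : A.Obj) (b : B.Obj) :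
    Φ a b ≫ B.hom b b = Φ a b := by
  conv_lhs => rw [← hΦ.1 a b, IsQuantaloid.iSup_comp]
  simp only [Category.assoc, hB.2.2, hΦ.1]

theorem hom_self_comp (hA : A.IsTR) (hΦ : IsRSDist Φ) (a : A.Obj) (b : B.Obj) :
    A.hom a a ≫ Φ a b = Φ a b := by
  conv_lhs => rw [← hΦ.2 a b, IsQuantaloid.comp_iSup]
  simp only [← Category.assoc, hA.2.1, hΦ.2]

omit [IsQuantaloid Q] in
theorem isDist (hΦ : IsRSDist Φ) : IsDist Φ :=
  ⟨fun a b b' => (le_iSup (fun b => Φ a b ≫ B.hom b b') b).trans (hΦ.1 a b').le,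
    fun a' a b => (le_iSup (fun a => A.hom a' a ≫ Φ a b) a).trans (hΦ.2 a' b).le⟩

end IsRSDist

omit [IsQuantaloid Q] in
/-- A distributor-like matrix on which endo-hom-arrows act as identities is regular. -/
theorem IsDist.isRSDist {A B : QGraph Q} {Φ : QMat A B} (hΦ : IsDist Φ)
    (hl : ∀ a b, A.hom a a ≫ Φ a b = Φ a b) (hr : ∀ a b, Φ a b ≫ B.hom b b = Φ a b) :
    IsRSDist Φ :=
  ⟨fun a b' => le_antisymm (iSup_le fun b => hΦ.1 a b b')
      ((hr a b').ge.trans (le_iSup (fun b => Φ a b ≫ B.hom b b') b')),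
    fun a' b => le_antisymm (iSup_le fun a => hΦ.2 a' a b)
      ((hl a' b).ge.trans (le_iSup (fun a => A.hom a' a ≫ Φ a b) a'))⟩

namespace QGraph

omit [IsQuantaloid Q] in
theorem hat_isNormal (A : QGraph Q) (hA : A.IsTR) : (A.hat hA).IsNormal :=
  fun _ => rfl

theorem hat_isCat (A : QGraph Q) (hA : A.IsTR) : (A.hat hA).IsCat :=
  ⟨hA.1, fun _ => le_rfl⟩

/-- The `Q`-graph underlying an `Idm(Q)`-graph. -/
def underlying (C : QGraph (Idm Q)) : QGraph Q where
  Obj := C.Obj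
  ty c := (C.ty c).obj
  hom c c' := (C.hom c c').1

omit [∀ X Y : Q, CompleteLattice (X ⟶ Y)] [IsQuantaloid Q] in
theorem underlying_hom_self {C : QGraph (Idm Q)} (hC : C.IsNormal) (c : C.Obj) :
    C.underlying.hom c c = (C.ty c).e :=
  congrArg Subtype.val (hC c)

theorem underlying_isTR {C : QGraph (Idm Q)} (hC : C.IsCat) (hn : C.IsNormal) :
    C.underlying.IsTR :=
  ⟨hC.1,
    fun c c' =>
      (congrArg (· ≫ (C.hom c c').1) (underlying_hom_self hn c)).trans (C.hom c c').2.1,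
    fun c c' =>
      (congrArg ((C.hom c' c).1 ≫ ·) (underlying_hom_self hn c)).trans (C.hom c' c).2.2⟩

omit [∀ X Y : Q, CompleteLattice (X ⟶ Y)] [IsQuantaloid Q] in
theorem mk_eq_of_idem_eq (C : QGraph (Idm Q)) (e : ∀ c, (C.ty c).obj ⟶ (C.ty c).obj)
    (he : ∀ c, e c = (C.ty c).e) (hi : ∀ c, e c ≫ e c = e c)
    (hl : ∀ c c', e c ≫ (C.hom c c').1 = (C.hom c c').1)
    (hr : ∀ c c', (C.hom c c').1 ≫ e c' = (C.hom c c').1) :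
    (⟨C.Obj, fun c => ⟨(C.ty c).obj, e c, hi c⟩,
      fun c c' => ⟨(C.hom c c').1, hl c c', hr c c'⟩⟩ : QGraph (Idm Q)) = C := by
  obtain rfl : e = fun c => (C.ty c).e := funext he
  rfl

theorem hat_underlying {C : QGraph (Idm Q)} (hC : C.IsCat) (hn : C.IsNormal) :
    C.underlying.hat (underlying_isTR hC hn) = C :=
  mk_eq_of_idem_eq C (fun c => (C.hom c c).1) (underlying_hom_self hn)
    (fun c => (underlying_isTR hC hn).2.1 c c) (underlying_isTR hC hn).2.1
    fun c c' => (underlying_isTR hC hn).2.2 c' c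

end QGraph

/-- the homomorphism `(ˆ) : TRSDist(Q) → Dist_n(Idm(Q))` is an equivalence
of quantaloids: `Â` is a normal `Idm(Q)`-category, `(ˆ)` is fully faithful (an
order-isomorphism on each hom-lattice, acting entrywise by `Φ̂(b,a) = Φ(b,a)`), and it is
surjective on objects. -/
theorem hat_equivalence_onto_normal [IsQuantaloid Q] :
    -- object part is well defined
    (∀ (A : QGraph Q) (hA : A.IsTR), (A.hat hA).IsCat ∧ (A.hat hA).IsNormal) ∧
    -- fully faithful: entrywise bijection between regular semidistributors and distributors
    (∀ (A B : QGraph Q) (hA : A.IsTR) (hB : B.IsTR),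
      (∀ Φ : QMat A B, IsRSDist Φ →
        ∃ Θ : QMat (A.hat hA) (B.hat hB), IsDist Θ ∧ ∀ a b, (Θ a b).1 = Φ a b) ∧
      (∀ Θ : QMat (A.hat hA) (B.hat hB), IsDist Θ →
        ∃ Φ : QMat A B, IsRSDist Φ ∧ ∀ a b, (Θ a b).1 = Φ a b) ∧
      -- order-isomorphism on the hom-lattices
      (∀ Θ Θ' : QMat (A.hat hA) (B.hat hB), IsDist Θ → IsDist Θ' →
        ((∀ a b, Θ a b ≤ Θ' a b) ↔ (∀ a b, (Θ a b).1 ≤ (Θ' a b).1)))) ∧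
    -- surjective on objects
    (∀ C : QGraph (Idm Q), C.IsCat → C.IsNormal →
      ∃ (A : QGraph Q) (hA : A.IsTR), A.hat hA = C) := by
  refine ⟨fun A hA => ⟨A.hat_isCat hA, A.hat_isNormal hA⟩, fun A B hA hB => ⟨?_, ?_, ?_⟩,
    fun C hC hn => ⟨C.underlying, QGraph.underlying_isTR hC hn, QGraph.hat_underlying hC hn⟩⟩
  · intro Φ hΦ
    exact ⟨fun a b => ⟨Φ a b, hΦ.hom_self_comp hA a b, hΦ.comp_hom_self hB a b⟩,
      hΦ.isDist, fun _ _ => rfl⟩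
  · intro Θ hΘ
    have hd : IsDist (A := A) (B := B) fun a b => (Θ a b).1 := hΘ
    exact ⟨fun a b => (Θ a b).1,
      hd.isRSDist (fun a b => (Θ a b).2.1) (fun a b => (Θ a b).2.2), fun _ _ => rfl⟩
  · intro Θ Θ' _ _
    exact Iff.rfl
end

section
/- In the split-idempotent completion Idm(Q) of a quantaloid Q, every monad splits (every monad in a quantaloid is idempotent, and all idempotents split in Idm(Q)); consequently the full embedding Dist_n(Idm(Q)) → Dist(Idm(Q)) of the normal Idm(Q)-categories into all Idm(Q)-categories is an equivalence of quantaloids. -/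
open CategoryTheory

universe u

variable (Q : Type u) [SmallCategory Q] [∀ X Y : Q, CompleteLattice (X ⟶ Y)]

variable {Q}

variable [IsQuantaloid Q]

namespace IsQuantaloid

theorem comp_mono {X Y Z : Q} {f f' : X ⟶ Y} {g g' : Y ⟶ Z} (hf : f ≤ f') (hg : g ≤ g') :
    f ≫ g ≤ f' ≫ g' := by
  have hl : f ≫ g ≤ f' ≫ g := by
    have h := sSup_comp {f, f'} g
    rw [sSup_pair, sup_eq_right.mpr hf] at h
    rw [h]
    exact le_iSup₂_of_le f (Set.mem_insert _ _) le_rfl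
  have hr : f' ≫ g ≤ f' ≫ g' := by
    have h := comp_sSup f' {g, g'}
    rw [sSup_pair, sup_eq_right.mpr hg] at h
    rw [h]
    exact le_iSup₂_of_le g (Set.mem_insert _ _) le_rfl
  exact hl.trans hr

end IsQuantaloid

namespace Idm

theorem comp_mono {p q r : Idm Q} {f f' : p ⟶ q} {g g' : q ⟶ r} (hf : f ≤ f') (hg : g ≤ g') :
    f ≫ g ≤ f' ≫ g' :=
  IsQuantaloid.comp_mono (Q := Q) (f := f.1) (f' := f'.1) (g := g.1) (g' := g'.1) hf hg

theorem monad_idem {p : Idm Q} {t : p ⟶ p} (h1 : 𝟙 p ≤ t) (h2 : t ≫ t ≤ t) : t ≫ t = t := by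
  refine le_antisymm h2 ?_
  simpa using comp_mono h1 (le_refl t)

theorem idem_splits {p : Idm Q} {t : p ⟶ p} (ht : t ≫ t = t) :
    ∃ (q : Idm Q) (f : p ⟶ q) (u : q ⟶ p), f ≫ u = t ∧ u ≫ f = 𝟙 q := by
  have h : t.1 ≫ t.1 = t.1 := congrArg Subtype.val ht
  exact ⟨⟨p.obj, t.1, h⟩, ⟨t.1, t.2.1, h⟩, ⟨t.1, h, t.2.2⟩, ht, Subtype.ext h⟩

end Idm

/-- A category over `Idm(Q)` is totally regular. -/
theorem QGraph.IsCat.isTR {C : QGraph (Idm Q)} (hC : C.IsCat) : C.IsTR := by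
  refine ⟨hC.1, fun a a' => le_antisymm (hC.1 a a a') ?_,
    fun a a' => le_antisymm (hC.1 a' a a) ?_⟩
  · simpa using Idm.comp_mono (hC.2 a) (le_refl (C.hom a a'))
  · simpa using Idm.comp_mono (le_refl (C.hom a' a)) (hC.2 a)

/-- The normal category obtained from an `Idm(Q)`-category by splitting its endo-hom-arrows. -/
def QGraph.normalization (C : QGraph (Idm Q)) (hC : C.IsTR) : QGraph (Idm Q) where
  Obj := C.Obj
  ty a := ⟨(C.ty a).obj, (C.hom a a).1, congrArg Subtype.val (hC.2.1 a a)⟩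
  hom a a' := ⟨(C.hom a a').1, congrArg Subtype.val (hC.2.1 a a'),
    congrArg Subtype.val (hC.2.2 a' a)⟩

/-- in `Idm(Q)` every monad is idempotent, every idempotent splits, hence
every monad splits; consequently every `Idm(Q)`-category is isomorphic in `Dist(Idm(Q))`
to a normal one, i.e. the full embedding `Dist_n(Idm(Q)) → Dist(Idm(Q))` is an
equivalence of quantaloids. -/
theorem monads_split_in_Idm [IsQuantaloid Q] :
    -- every monad in the quantaloid Idm(Q) is idempotent
    (∀ (p : Idm Q) (t : p ⟶ p), 𝟙 p ≤ t → t ≫ t ≤ t → t ≫ t = t) ∧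
    -- every idempotent splits in Idm(Q)
    (∀ (p : Idm Q) (t : p ⟶ p), t ≫ t = t →
      ∃ (q : Idm Q) (f : p ⟶ q) (u : q ⟶ p), f ≫ u = t ∧ u ≫ f = 𝟙 q) ∧
    -- hence every monad in Idm(Q) splits
    (∀ (p : Idm Q) (t : p ⟶ p), 𝟙 p ≤ t → t ≫ t ≤ t →
      ∃ (q : Idm Q) (f : p ⟶ q) (u : q ⟶ p), f ≫ u = t ∧ u ≫ f = 𝟙 q) ∧
    -- consequently: every Idm(Q)-category is isomorphic in Dist(Idm(Q)) to a normal one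
    (∀ C : QGraph (Idm Q), C.IsCat →
      ∃ D : QGraph (Idm Q), D.IsCat ∧ D.IsNormal ∧
        ∃ (Φ : QMat C D) (Ψ : QMat D C), IsDist Φ ∧ IsDist Ψ ∧
          (∀ c c', matComp Φ Ψ c c' = C.hom c c') ∧
          (∀ d d', matComp Ψ Φ d d' = D.hom d d')) := by
  refine ⟨fun p t => Idm.monad_idem, fun p t => Idm.idem_splits,
    fun p t h1 h2 => Idm.idem_splits (Idm.monad_idem h1 h2), fun C hC => ?_⟩
  have hT := hC.isTR
  refine ⟨C.normalization hT, ⟨fun a b c => hC.1 a b c, fun a => le_rfl⟩, fun a => rfl,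
    fun a b => ⟨(C.hom a b).1, (C.hom a b).2.1, congrArg Subtype.val (hT.2.2 b a)⟩,
    fun a b => ⟨(C.hom a b).1, congrArg Subtype.val (hT.2.1 a b), (C.hom a b).2.2⟩,
    ⟨fun a b c => hC.1 a b c, fun a b c => hC.1 a b c⟩,
    ⟨fun a b c => hC.1 a b c, fun a b c => hC.1 a b c⟩,
    fun c c' => le_antisymm (iSup_le fun b => hC.1 c b c') ?_,
    fun c c' => le_antisymm (iSup_le fun b => hC.1 c b c') ?_⟩
  · exact le_iSup_of_le c (hT.2.1 c c').ge
  · exact le_iSup_of_le (f := fun b : C.Obj => _) c (hT.2.1 c c').ge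
end
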